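/- For every integer N ≥ 2 and every δ > 0, the map s ↦ ℋ₁'(s)/s^{N−1} is strictly decreasing on (0, ∞). -/

import Mathlib

/-- The function `ℋ₁` of the paper. -/
noncomputable def H1 (N : ℕ) (δ : ℝ) (s : ℝ) : ℝ :=
  if s = 0 then 0
  else if |s| < ((N : ℝ) - 1) * δ then
    -(1 / (N : ℝ)) * |s| ^ N * Real.log (|s| ^ N)
  else
    -(1 / (N : ℝ)) * |s| ^ N * (Real.log ((((N : ℝ) - 1) * δ) ^ N) + N + 1)
      + (N : ℝ) * δ * |s| ^ (N - 1)
      - (((N : ℝ) - 1) * δ) ^ N / ((N : ℝ) * ((N : ℝ) - 1))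

/-- The function `ℋ₂` of the paper. -/
noncomputable def H2 (N : ℕ) (δ : ℝ) (s : ℝ) : ℝ :=
  if |s| ≤ ((N : ℝ) - 1) * δ then 0
  else
    (1 / (N : ℝ)) * |s| ^ N * Real.log (|s| ^ N / (((N : ℝ) - 1) * δ) ^ N)
      + (N : ℝ) * δ * |s| ^ (N - 1)
      - (((N : ℝ) + 1) / (N : ℝ)) * |s| ^ N
      - (((N : ℝ) - 1) * δ) ^ N / ((N : ℝ) * ((N : ℝ) - 1))

/-- At positive points up to the threshold, included, `H1` is given by its logarithmic branch. -/
lemma H1_of_le (m : ℕ) {δ s : ℝ} (hs : 0 < s) (h : s ≤ ((m : ℝ) + 1) * δ) :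
    H1 (m + 2) δ s = -(s ^ (m + 2) * Real.log s) := by
  have hm : (0 : ℝ) < (m : ℝ) + 1 := by positivity
  have hc : ((m + 2 : ℕ) : ℝ) - 1 = (m : ℝ) + 1 := by push_cast; ring
  unfold H1
  rw [if_neg hs.ne', abs_of_pos hs, hc]
  rcases h.lt_or_eq with h | h
  · rw [if_pos h, Real.log_pow]
    push_cast
    field_simp
  · rw [if_neg h.not_lt, ← h, Real.log_pow]
    have hδ : δ = s / (m + 1) := by rw [h]; field_simp
    rw [hδ, show m + 2 - 1 = m + 1 from rfl]
    push_cast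
    field_simp
    ring

/-- At positive points from the threshold on, `H1` is given by its polynomial branch. -/
lemma H1_of_ge (m : ℕ) {δ s : ℝ} (hs : 0 < s) (h : ((m : ℝ) + 1) * δ ≤ s) :
    H1 (m + 2) δ s =
      -(1 / ((m : ℝ) + 2)) * s ^ (m + 2) *
          (((m : ℝ) + 2) * Real.log (((m : ℝ) + 1) * δ) + (m + 2) + 1)
        + ((m : ℝ) + 2) * δ * s ^ (m + 1)
        - (((m : ℝ) + 1) * δ) ^ (m + 2) / (((m : ℝ) + 2) * ((m : ℝ) + 1)) := by
  have hc : ((m + 2 : ℕ) : ℝ) - 1 = (m : ℝ) + 1 := by push_cast; ring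
  unfold H1
  rw [if_neg hs.ne', abs_of_pos hs, hc, if_neg h.not_gt, Real.log_pow,
    show m + 2 - 1 = m + 1 from rfl]
  push_cast
  rfl

/-- The quotient `H1'(s) / s ^ (N - 1)` for `N = m + 2` and threshold `a`, in closed form. -/
noncomputable def H1DerivQuotient (m : ℕ) (a s : ℝ) : ℝ :=
  ((m : ℝ) + 2) * (a / max s a - Real.log (min s a) - 1) - 1

lemma hasDerivWithinAt_H1_Iic (m : ℕ) {δ s : ℝ} (hs : 0 < s) (h : s ≤ ((m : ℝ) + 1) * δ) :
    HasDerivWithinAt (H1 (m + 2) δ) (s ^ (m + 1) * H1DerivQuotient m (((m : ℝ) + 1) * δ) s)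
      (Set.Iic (((m : ℝ) + 1) * δ)) s := by
  have hd := ((hasDerivAt_pow (m + 2) s).mul (Real.hasDerivAt_log hs.ne')).neg
  have ha : ((m : ℝ) + 1) * δ ≠ 0 := (hs.trans_le h).ne'
  refine (hd.hasDerivWithinAt.congr_deriv ?_).congr_of_eventuallyEq ?_ (H1_of_le m hs h)
  · rw [H1DerivQuotient, max_eq_right h, min_eq_left h, div_self ha,
      show m + 2 - 1 = m + 1 from rfl]
    push_cast
    field_simp
    ring
  · filter_upwards [self_mem_nhdsWithin, mem_nhdsWithin_of_mem_nhds (Ioi_mem_nhds hs)]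
      with x hx hx0 using H1_of_le m hx0 hx

lemma hasDerivWithinAt_H1_Ici (m : ℕ) {δ s : ℝ} (hs : 0 < s) (h : ((m : ℝ) + 1) * δ ≤ s) :
    HasDerivWithinAt (H1 (m + 2) δ) (s ^ (m + 1) * H1DerivQuotient m (((m : ℝ) + 1) * δ) s)
      (Set.Ici (((m : ℝ) + 1) * δ)) s := by
  have hd := ((((hasDerivAt_pow (m + 2) s).const_mul (-(1 / ((m : ℝ) + 2)))).mul_const
    (((m : ℝ) + 2) * Real.log (((m : ℝ) + 1) * δ) + (m + 2) + 1)).add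
    ((hasDerivAt_pow (m + 1) s).const_mul (((m : ℝ) + 2) * δ))).sub_const
    ((((m : ℝ) + 1) * δ) ^ (m + 2) / (((m : ℝ) + 2) * ((m : ℝ) + 1)))
  refine (hd.hasDerivWithinAt.congr_deriv ?_).congr_of_eventuallyEq ?_ (H1_of_ge m hs h)
  · rw [H1DerivQuotient, max_eq_left h, min_eq_right h, show m + 2 - 1 = m + 1 from rfl,
      show m + 1 - 1 = m from rfl]
    push_cast
    generalize Real.log (((m : ℝ) + 1) * δ) = L
    field_simp
    ring
  · filter_upwards [self_mem_nhdsWithin, mem_nhdsWithin_of_mem_nhds (Ioi_mem_nhds hs)]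
      with x hx hx0 using H1_of_ge m hx0 hx

lemma hasDerivAt_H1 (m : ℕ) {δ s : ℝ} (hs : 0 < s) :
    HasDerivAt (H1 (m + 2) δ) (s ^ (m + 1) * H1DerivQuotient m (((m : ℝ) + 1) * δ) s) s := by
  rcases lt_trichotomy s (((m : ℝ) + 1) * δ) with h | h | h
  · exact (hasDerivWithinAt_H1_Iic m hs h.le).hasDerivAt (Iic_mem_nhds h)
  · have := (hasDerivWithinAt_H1_Iic m hs h.le).union (hasDerivWithinAt_H1_Ici m hs h.ge)
    rwa [Set.Iic_union_Ici, hasDerivWithinAt_univ] at this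
  · exact (hasDerivWithinAt_H1_Ici m hs h.le).hasDerivAt (Ici_mem_nhds h)

lemma strictAntiOn_H1DerivQuotient (m : ℕ) {a : ℝ} (ha : 0 < a) :
    StrictAntiOn (H1DerivQuotient m a) (Set.Ioi 0) := by
  intro x (hx : 0 < x) y (hy : 0 < y) hxy
  have hdiv : a / max y a ≤ a / max x a := by gcongr
  have hlog : Real.log (min x a) ≤ Real.log (min y a) :=
    Real.log_le_log (lt_min hx ha) (min_le_min_right a hxy.le)
  have key : a / max y a - Real.log (min y a) < a / max x a - Real.log (min x a) := by
    rcases lt_or_ge x a with h | h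
    · have : Real.log (min x a) < Real.log (min y a) :=
        Real.log_lt_log (lt_min hx ha) (by rw [min_eq_left h.le]; exact lt_min hxy h)
      linarith
    · have : a / max y a < a / max x a := by
        rw [max_eq_left h, max_eq_left (h.trans hxy.le)]
        exact div_lt_div_of_pos_left ha hx hxy
      linarith
  unfold H1DerivQuotient
  gcongr

/-- The map `s ↦ H1'(s)/s^(N-1)` is strictly decreasing on `(0, ∞)`. -/
theorem stmt_13 (N : ℕ) (hN : 2 ≤ N) (δ : ℝ) (hδ : 0 < δ) :
    StrictAntiOn (fun s : ℝ => deriv (H1 N δ) s / s ^ (N - 1)) (Set.Ioi 0) := by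
  obtain ⟨m, rfl⟩ := Nat.exists_eq_add_of_le' hN
  refine (strictAntiOn_H1DerivQuotient m (a := ((m : ℝ) + 1) * δ) (by positivity)).congr ?_
  intro s (hs : 0 < s)
  simp only [(hasDerivAt_H1 m hs).deriv, show m + 2 - 1 = m + 1 from rfl]
  field_simp
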